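/- Let d ≥ 1, γ ∈ (0,1) and δ > 0 satisfy 4δ(1−γ) ≥ 1. Then there is a constant C > 0, depending only on d, γ, δ, such that for every F ∈ L¹_loc(ℂ^d) with ∫_{ℂ^d} |F(z)| e^{−γ|z|²} dλ(z) < ∞, the integral defining (Π_A F)(z) converges absolutely for every z ∈ ℂ^d and ∫_{ℂ^d} |(Π_A F)(z)| e^{−δ|z|²} dλ(z) ≤ C ∫_{ℂ^d} |F(z)| e^{−γ|z|²} dλ(z). -/

import Mathlib

open MeasureTheory Filter
open scoped ENNReal

noncomputable section

/-- `ℂ^d`, identified with `ℝ^{2d}`, with the Euclidean norm. -/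
abbrev CSp (d : ℕ) := EuclideanSpace ℂ (Fin d)

instance {d : ℕ} : InnerProductSpace ℝ (CSp d) := InnerProductSpace.complexToReal
instance {d : ℕ} : MeasurableSpace (CSp d) := borel _
instance {d : ℕ} : BorelSpace (CSp d) := ⟨rfl⟩

/-- The pairing `(z,w) = ∑ z_j conj(w_j)`. -/
def pairB {d : ℕ} (z w : CSp d) : ℂ := ∑ j, z j * (starRingEnd ℂ) (w j)

/-- The density of the Gaussian measure `dμ = π^{−d} e^{−|z|²} dλ`. -/
def gaussW (d : ℕ) (w : CSp d) : ℝ := (Real.pi ^ d)⁻¹ * Real.exp (-‖w‖ ^ 2)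

/-- The Bargmann projection `(Π_A F)(z) = ∫ F(w) e^{(z,w)} dμ(w)`. -/
def PiA (d : ℕ) (F : CSp d → ℂ) (z : CSp d) : ℂ :=
  ∫ w : CSp d, F w * Complex.exp (pairB z w) * Complex.ofReal (gaussW d w)

lemma pairB_eq_inner {d : ℕ} (z w : CSp d) : pairB z w = inner ℂ w z := by
  simp [pairB, PiLp.inner_apply]

lemma re_pairB {d : ℕ} (z w : CSp d) : (pairB z w).re = inner ℝ z w := by
  rw [pairB_eq_inner, real_inner_comm]
  rfl

/-- Completing the square: `2a(z,w) = |aw|² + |z|² - |z - aw|²`, with `a = (2δ)⁻¹`. -/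
lemma re_pairB_eq {d : ℕ} {δ : ℝ} (hδ : 0 < δ) (z w : CSp d) :
    (pairB z w).re = δ * ‖z‖ ^ 2 + ‖w‖ ^ 2 / (4 * δ) - δ * ‖z - (2 * δ)⁻¹ • w‖ ^ 2 := by
  rw [re_pairB, norm_sub_sq_real, real_inner_smul_right, norm_smul, Real.norm_eq_abs, mul_pow,
    sq_abs]
  field_simp
  ring

lemma continuous_pairB {d : ℕ} (z : CSp d) : Continuous fun w : CSp d => pairB z w := by
  simp only [pairB_eq_inner]
  fun_prop

lemma continuous_gaussW (d : ℕ) : Continuous (gaussW d) := by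
  unfold gaussW
  fun_prop

lemma gaussW_nonneg (d : ℕ) (w : CSp d) : 0 ≤ gaussW d w := by
  unfold gaussW
  positivity

lemma norm_integrand {d : ℕ} (F : CSp d → ℂ) (z w : CSp d) :
    ‖F w * Complex.exp (pairB z w) * Complex.ofReal (gaussW d w)‖ =
      ‖F w‖ * Real.exp (pairB z w).re * gaussW d w := by
  rw [norm_mul, norm_mul, Complex.norm_exp, Complex.norm_real,
    Real.norm_of_nonneg (gaussW_nonneg d w)]

lemma exp_re_pairB_mul_gaussW_le {d : ℕ} {γ δ : ℝ} (hδ : 0 < δ)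
    (hγδ : 1 ≤ 4 * δ * (1 - γ)) (z w : CSp d) :
    Real.exp (pairB z w).re * gaussW d w * Real.exp (-(δ * ‖z‖ ^ 2)) ≤
      Real.exp (-(γ * ‖w‖ ^ 2)) *
        ((Real.pi ^ d)⁻¹ * Real.exp (-δ * ‖z - (2 * δ)⁻¹ • w‖ ^ 2)) := by
  have hw : ‖w‖ ^ 2 / (4 * δ) ≤ (1 - γ) * ‖w‖ ^ 2 := by
    rw [div_le_iff₀ (by positivity)]
    nlinarith [sq_nonneg ‖w‖]
  calc Real.exp (pairB z w).re * gaussW d w * Real.exp (-(δ * ‖z‖ ^ 2))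
      = (Real.pi ^ d)⁻¹ * Real.exp ((pairB z w).re + -‖w‖ ^ 2 + -(δ * ‖z‖ ^ 2)) := by
        rw [gaussW, Real.exp_add, Real.exp_add]
        ring
    _ ≤ (Real.pi ^ d)⁻¹ *
          Real.exp (-(γ * ‖w‖ ^ 2) + -δ * ‖z - (2 * δ)⁻¹ • w‖ ^ 2) := by
        refine mul_le_mul_of_nonneg_left (Real.exp_le_exp.2 ?_) (by positivity)
        rw [re_pairB_eq hδ]
        linarith
    _ = _ := by
        rw [Real.exp_add]
        ring

lemma lintegral_gaussian_translate {d : ℕ} {δ : ℝ} (hδ : 0 < δ) (a : CSp d) :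
    ∫⁻ z : CSp d, ENNReal.ofReal ((Real.pi ^ d)⁻¹ * Real.exp (-δ * ‖z - a‖ ^ 2)) =
      ENNReal.ofReal ((Real.pi ^ d)⁻¹ * ∫ z : CSp d, Real.exp (-δ * ‖z‖ ^ 2)) := by
  have hint : Integrable (fun z : CSp d => Real.exp (-δ * ‖z‖ ^ 2)) := by
    refine Integrable.of_integral_ne_zero ?_
    rw [GaussianFourier.integral_rexp_neg_mul_sq_norm hδ]
    positivity
  rw [lintegral_sub_right_eq_self
    (fun z : CSp d => ENNReal.ofReal ((Real.pi ^ d)⁻¹ * Real.exp (-δ * ‖z‖ ^ 2))) a,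
    ← ofReal_integral_eq_lintegral_ofReal (hint.const_mul _)
      (Eventually.of_forall fun z => by positivity), integral_const_mul]

lemma integrable_bargmann_integrand {d : ℕ} {γ : ℝ} (hγ : γ < 1) {F : CSp d → ℂ}
    (hF : AEStronglyMeasurable F volume)
    (hfin : ∫⁻ z : CSp d, ENNReal.ofReal (‖F z‖ * Real.exp (-(γ * ‖z‖ ^ 2))) < ⊤)
    (z : CSp d) :
    Integrable (fun w => F w * Complex.exp (pairB z w) * Complex.ofReal (gaussW d w)) volume := by
  have hγ' : 0 < 1 - γ := sub_pos.2 hγ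
  have hbound : Integrable (fun w : CSp d => ‖F w‖ * Real.exp (-(γ * ‖w‖ ^ 2))) volume := by
    refine ⟨hF.norm.mul (Continuous.aestronglyMeasurable (by fun_prop)), ?_⟩
    rwa [hasFiniteIntegral_iff_ofReal (Eventually.of_forall fun w => by positivity)]
  set η : ℝ := (4 * (1 - γ))⁻¹ with hη
  have hη0 : 0 < η := by positivity
  have hγη : 1 ≤ 4 * η * (1 - γ) := by
    rw [hη]
    field_simp
    rfl
  refine (hbound.mul_const ((Real.pi ^ d)⁻¹ * Real.exp (η * ‖z‖ ^ 2))).mono' ?_ ?_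
  · exact (hF.mul (Complex.continuous_exp.comp (continuous_pairB z)).aestronglyMeasurable).mul
      (Complex.continuous_ofReal.comp (continuous_gaussW d)).aestronglyMeasurable
  · refine Eventually.of_forall fun w => ?_
    rw [norm_integrand, mul_assoc, mul_assoc]
    refine mul_le_mul_of_nonneg_left ?_ (norm_nonneg _)
    have h := exp_re_pairB_mul_gaussW_le hη0 hγη z w
    rw [Real.exp_neg (η * _), ← div_eq_mul_inv, div_le_iff₀ (Real.exp_pos _)] at h
    refine h.trans ?_
    rw [mul_assoc, mul_assoc]
    gcongr
    refine mul_le_of_le_one_left (Real.exp_nonneg _) (Real.exp_le_one_iff.2 ?_)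
    have : 0 ≤ η * ‖z - (2 * η)⁻¹ • w‖ ^ 2 := by positivity
    linarith

lemma ofReal_norm_PiA_mul_exp_le {d : ℕ} {γ δ : ℝ} (hδ : 0 < δ)
    (hγδ : 1 ≤ 4 * δ * (1 - γ)) (F : CSp d → ℂ) (z : CSp d) :
    ENNReal.ofReal (‖PiA d F z‖ * Real.exp (-(δ * ‖z‖ ^ 2))) ≤
      ∫⁻ w : CSp d, ENNReal.ofReal (‖F w‖ * Real.exp (-(γ * ‖w‖ ^ 2))) *
        ENNReal.ofReal ((Real.pi ^ d)⁻¹ * Real.exp (-δ * ‖z - (2 * δ)⁻¹ • w‖ ^ 2)) := by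
  rw [ENNReal.ofReal_mul (norm_nonneg _), ofReal_norm]
  calc _ ≤ (∫⁻ w : CSp d, ‖F w * Complex.exp (pairB z w) * Complex.ofReal (gaussW d w)‖ₑ) *
          ENNReal.ofReal (Real.exp (-(δ * ‖z‖ ^ 2))) := by
        gcongr
        exact enorm_integral_le_lintegral_enorm _
    _ = ∫⁻ w : CSp d, ‖F w * Complex.exp (pairB z w) * Complex.ofReal (gaussW d w)‖ₑ *
          ENNReal.ofReal (Real.exp (-(δ * ‖z‖ ^ 2))) :=
        (lintegral_mul_const' _ _ ENNReal.ofReal_ne_top).symm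
    _ ≤ _ := by
        refine lintegral_mono fun w => ?_
        rw [← ofReal_norm, ← ENNReal.ofReal_mul (norm_nonneg _),
          ← ENNReal.ofReal_mul (by positivity), norm_integrand]
        refine ENNReal.ofReal_le_ofReal ?_
        simpa only [mul_assoc] using
          mul_le_mul_of_nonneg_left (exp_re_pairB_mul_gaussW_le hδ hγδ z w) (norm_nonneg (F w))

/-- if `γ ∈ (0,1)`, `δ > 0` and `4δ(1−γ) ≥ 1`, then the Bargmann projection
satisfies `‖(Π_A F) e^{−δ|·|²}‖_{L¹} ≤ C ‖F e^{−γ|·|²}‖_{L¹}`, with a constant depending only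
on `d, γ, δ`. -/
theorem stmt6 (d : ℕ) (hd : 1 ≤ d) (γ δ : ℝ) (hγ0 : 0 < γ) (hγ1 : γ < 1) (hδ : 0 < δ)
    (hγδ : 1 ≤ 4 * δ * (1 - γ)) :
    ∃ C : ℝ, 0 < C ∧
      ∀ F : CSp d → ℂ, LocallyIntegrable F volume →
        (∫⁻ z : CSp d, ENNReal.ofReal (‖F z‖ * Real.exp (-(γ * ‖z‖ ^ 2)))) < ⊤ →
        (∀ z : CSp d, Integrable
          (fun w => F w * Complex.exp (pairB z w) * Complex.ofReal (gaussW d w)) volume) ∧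
        (∫⁻ z : CSp d, ENNReal.ofReal (‖PiA d F z‖ * Real.exp (-(δ * ‖z‖ ^ 2)))) ≤
          ENNReal.ofReal C *
            ∫⁻ z : CSp d, ENNReal.ofReal (‖F z‖ * Real.exp (-(γ * ‖z‖ ^ 2))) := by
  refine ⟨(Real.pi ^ d)⁻¹ * ∫ z : CSp d, Real.exp (-δ * ‖z‖ ^ 2), ?_, fun F hF hfin => ⟨?_, ?_⟩⟩
  · rw [GaussianFourier.integral_rexp_neg_mul_sq_norm hδ]
    positivity
  · exact integrable_bargmann_integrand hγ1 hF.aestronglyMeasurable hfin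
  have hw : AEMeasurable
      (fun w : CSp d => ENNReal.ofReal (‖F w‖ * Real.exp (-(γ * ‖w‖ ^ 2)))) volume :=
    (hF.aestronglyMeasurable.norm.mul
      (Continuous.aestronglyMeasurable (by fun_prop))).aemeasurable.ennreal_ofReal
  have hk : Continuous fun p : CSp d × CSp d =>
      (Real.pi ^ d)⁻¹ * Real.exp (-δ * ‖p.1 - (2 * δ)⁻¹ • p.2‖ ^ 2) := by fun_prop
  refine (lintegral_mono (ofReal_norm_PiA_mul_exp_le hδ hγδ F)).trans_eq ?_
  rw [lintegral_lintegral_swap (hw.comp_snd.mul hk.measurable.ennreal_ofReal.aemeasurable)]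
  simp_rw [lintegral_const_mul' _ _ ENNReal.ofReal_ne_top, lintegral_gaussian_translate hδ]
  rw [lintegral_mul_const' _ _ ENNReal.ofReal_ne_top, mul_comm]
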